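/- arXiv:1702.00859 — 2 statements merged into one kernel-verified Lean document; each statement's English description precedes it below -/
import Mathlib

section
/- There exist universal constants n₀ ∈ ℕ and c > 0 with the following property. Let n ≥ n₀, let B be a smooth origin-symmetric convex body in ℝⁿ in the ℓ-position such that the standard basis of ℝⁿ is 1-unconditional with respect to ‖·‖_B. Then for all p with 1 ≤ p ≤ c·log n, p² · E(‖G‖_B^{2p−2} · Σᵢ₌₁ⁿ Fᵢ²(B,G)) ≤ n^{−1/16} · E‖G‖_B^{2p}, where Fᵢ(B,x) := ⟨grad_B(x), eᵢ⟩ · 1{|⟨grad_B(x), eᵢ⟩| ≤ n^{−1/8}·E‖G‖_B} and G is the standard Gaussian vector in ℝⁿ. -/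
open MeasureTheory ProbabilityTheory Real
open scoped ENNReal RealInnerProductSpace

noncomputable section

/-- `ℝⁿ` with the Euclidean structure. -/
abbrev Euc (n : ℕ) := EuclideanSpace ℝ (Fin n)

/-- An origin-symmetric convex body in `ℝⁿ`: a compact convex set, symmetric about the
origin, with `0` in its interior. -/
def IsSymmConvexBody {n : ℕ} (B : Set (Euc n)) : Prop :=
  IsCompact B ∧ Convex ℝ B ∧ (0 : Euc n) ∈ interior B ∧ ∀ x ∈ B, -x ∈ B

/-- The standard Gaussian measure `γₙ` on `ℝⁿ`. -/
def stdGaussian (n : ℕ) : Measure (Euc n) :=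
  (Measure.pi fun _ : Fin n => gaussianReal 0 1).map
    ((EuclideanSpace.equiv (Fin n) ℝ).symm)

/-- `B` is in the ℓ-position: `ℓ(B, Id) = 1` (i.e. `E‖G‖_B² = 1`, where `‖·‖_B = gauge B`
is the Minkowski functional) and every linear operator `U` with `ℓ(B,U) ≤ 1` has
`|det U| ≤ 1`; together these say `sup{|det U| : ℓ(B,U) ≤ 1} = 1 = det Id`. -/
def IsEllPosition {n : ℕ} (B : Set (Euc n)) : Prop :=
  (∫ x, gauge B x ^ 2 ∂stdGaussian n) = 1 ∧
  ∀ U : Euc n →ₗ[ℝ] Euc n,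
    (∫ x, gauge B (U x) ^ 2 ∂stdGaussian n) ≤ 1 → |LinearMap.det U| ≤ 1

/-- The standard basis of `ℝⁿ` is `1`-unconditional for `‖·‖_B`. -/
def StdUncond {n : ℕ} (B : Set (Euc n)) : Prop :=
  ∀ (x σ : Fin n → ℝ), (∀ i, σ i = 1 ∨ σ i = -1) →
    gauge B ((EuclideanSpace.equiv (Fin n) ℝ).symm fun i => σ i * x i) =
      gauge B ((EuclideanSpace.equiv (Fin n) ℝ).symm x)

/-- The 'flat part' of the `i`-th coordinate of the gradient:
`Fᵢ(B,x) = ⟨grad_B(x), eᵢ⟩·1{|⟨grad_B(x), eᵢ⟩| ≤ n^{−1/8}·E‖G‖_B}`. -/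
def flatPart {n : ℕ} (B : Set (Euc n)) (gradB : Euc n → Euc n) (i : Fin n) (x : Euc n) : ℝ :=
  if |gradB x i| ≤ (n : ℝ) ^ (-(1 : ℝ) / 8) * ∫ y, gauge B y ∂stdGaussian n then
    gradB x i
  else 0

open Filter Topology

instance isGaussian_stdGaussian_euc (n : ℕ) : IsGaussian (_root_.stdGaussian n) := by
  have h : _root_.stdGaussian n = ProbabilityTheory.stdGaussian (Euc n) := by
    rw [← map_pi_eq_stdGaussian]
    rfl
  rw [h]
  infer_instance

lemma map_coord_stdGaussian {n : ℕ} (i : Fin n) :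
    (_root_.stdGaussian n).map (fun x => x i) = gaussianReal 0 1 := by
  rw [_root_.stdGaussian, Measure.map_map (by fun_prop) (by fun_prop)]
  exact (measurePreserving_eval (fun _ : Fin n => gaussianReal 0 1) i).map_eq

lemma integrable_abs_coord {n : ℕ} (i : Fin n) :
    Integrable (fun x => |x i|) (_root_.stdGaussian n) := by
  have h : Integrable (fun t : ℝ => |t|) ((_root_.stdGaussian n).map (fun x => x i)) := by
    rw [map_coord_stdGaussian]
    exact ((memLp_id_gaussianReal' 1 (by simp)).integrable le_rfl).abs
  exact h.comp_measurable (by fun_prop)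

lemma integral_abs_coord {n : ℕ} (i : Fin n) :
    ∫ x, |x i| ∂_root_.stdGaussian n = ∫ t, |t| ∂gaussianReal 0 1 := by
  rw [← map_coord_stdGaussian i, integral_map (by fun_prop) (by fun_prop)]

lemma integral_abs_gaussianReal_pos : 0 < ∫ t, |t| ∂gaussianReal 0 1 := by
  have hi : Integrable (fun t : ℝ => |t|) (gaussianReal 0 1) :=
    ((memLp_id_gaussianReal' 1 (by simp)).integrable le_rfl).abs
  rw [integral_pos_iff_support_of_nonneg (fun t => abs_nonneg t) hi]
  have hs : Function.support (fun t : ℝ => |t|) = {0}ᶜ := by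
    ext t
    simp
  have : NullSingletonClass (gaussianReal 0 1) := nullSingletonClass_gaussianReal (by simp)
  rw [hs, measure_compl (measurableSet_singleton 0) (by simp)]
  simp

lemma ae_ne_zero_stdGaussian {n : ℕ} (hn : 0 < n) : ∀ᵐ x ∂_root_.stdGaussian n, x ≠ 0 := by
  have : NullSingletonClass (gaussianReal 0 1) := nullSingletonClass_gaussianReal (by simp)
  have h : ∀ᵐ t ∂(_root_.stdGaussian n).map (fun x => x ⟨0, hn⟩), t ≠ (0 : ℝ) := by
    rw [map_coord_stdGaussian]
    exact Measure.ae_ne _ 0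
  filter_upwards [ae_of_ae_map (by fun_prop) h] with x hx h0
  exact hx (by simp [h0])

lemma integrable_gauge_rpow {n : ℕ} {B : Set (Euc n)} (hB : IsSymmConvexBody B) {q : ℝ}
    (hq : 0 ≤ q) : Integrable (fun x => gauge B x ^ q) (_root_.stdGaussian n) := by
  obtain ⟨-, hconv, h0, -⟩ := hB
  have hB0 : B ∈ 𝓝 0 := mem_interior_iff_mem_nhds.1 h0
  obtain ⟨r, hr, hball⟩ := Metric.mem_nhds_iff.1 hB0
  have hcont := continuous_gauge hconv hB0
  have hmem : MemLp (gauge B) (ENNReal.ofReal q) (_root_.stdGaussian n) := by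
    refine (IsGaussian.memLp_id (_root_.stdGaussian n) (ENNReal.ofReal q) (by simp)).of_le_mul
      (c := r⁻¹) hcont.aestronglyMeasurable (ae_of_all _ fun x => ?_)
    rw [Real.norm_of_nonneg (gauge_nonneg x), inv_mul_eq_div, le_div_iff₀ hr, mul_comm]
    exact mul_gauge_le_norm hball
  rcases hq.eq_or_lt with rfl | hq
  · simp
  have h := hmem.integrable_norm_rpow (by simpa using hq) ENNReal.ofReal_ne_top
  simpa [ENNReal.toReal_ofReal hq.le, abs_of_nonneg (gauge_nonneg _)] using h

/-- The slopes of the gauge at `x` in direction `v` converge to the directional derivative. -/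
lemma tendsto_slope_gauge {n : ℕ} {B : Set (Euc n)} {x g : Euc n}
    (h : HasGradientAt (gauge B) g x) (v : Euc n) :
    Tendsto (fun t : ℝ => t⁻¹ • (gauge B (x + t • v) - gauge B x)) (𝓝[>] 0)
      (𝓝 (∑ i, g i * v i)) := by
  have hl : HasDerivAt (fun t : ℝ => x + t • v) v 0 := by
    simpa using ((hasDerivAt_id (0 : ℝ)).smul_const v).const_add x
  have hd : HasDerivAt (fun t : ℝ => gauge B (x + t • v)) (∑ i, g i * v i) 0 := by
    have h' : HasFDerivAt (gauge B) (InnerProductSpace.toDual ℝ _ g) (x + (0 : ℝ) • v) := by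
      simpa using h.hasFDerivAt
    refine (h'.comp_hasDerivAt (0 : ℝ) hl).congr_deriv ?_
    simp [PiLp.inner_apply, mul_comm]
  simpa using hd.tendsto_slope_zero_right

lemma gradient_gauge_apply_le {n : ℕ} {B : Set (Euc n)} (hB : IsSymmConvexBody B) {x g : Euc n}
    (h : HasGradientAt (gauge B) g x) (v : Euc n) : ∑ i, g i * v i ≤ gauge B v := by
  refine le_of_tendsto (tendsto_slope_gauge h v) ?_
  filter_upwards [self_mem_nhdsWithin] with t ht
  have ht : 0 < t := ht
  have habs : Absorbent ℝ B := absorbent_nhds_zero (mem_interior_iff_mem_nhds.1 hB.2.2.1)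
  have h1 := gauge_add_le hB.2.1 habs x (t • v)
  rw [gauge_smul_of_nonneg ht.le, smul_eq_mul] at h1
  rw [smul_eq_mul, inv_mul_le_iff₀ ht]
  linarith

lemma gradient_gauge_apply_self {n : ℕ} {B : Set (Euc n)} {x g : Euc n}
    (h : HasGradientAt (gauge B) g x) : ∑ i, g i * x i = gauge B x := by
  refine tendsto_nhds_unique (tendsto_slope_gauge h x) (tendsto_const_nhds.congr' ?_)
  filter_upwards [self_mem_nhdsWithin] with t ht
  have ht : 0 < t := ht
  have hx : x + t • x = (1 + t) • x := by rw [add_smul, one_smul]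
  rw [hx, gauge_smul_of_nonneg (by positivity), smul_eq_mul, smul_eq_mul]
  field_simp
  ring

/-- The `ℓ₁`-norm of a gradient of an unconditional gauge is at most the gauge of the
all-ones vector. -/
lemma sum_abs_gradient_le {n : ℕ} {B : Set (Euc n)} (hB : IsSymmConvexBody B)
    (hU : StdUncond B) {x g : Euc n} (h : HasGradientAt (gauge B) g x) :
    ∑ i, |g i| ≤ gauge B (WithLp.toLp 2 fun _ => 1) := by
  have h1 := gradient_gauge_apply_le hB h (WithLp.toLp 2 fun i => if 0 ≤ g i then 1 else -1)
  have h2 := hU (fun _ => 1) (fun i => if 0 ≤ g i then 1 else -1)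
    (fun i => by split_ifs <;> simp)
  simp only [mul_one] at h2
  refine le_trans (Finset.sum_le_sum fun i _ => ?_) (h1.trans h2.le)
  by_cases hi : 0 ≤ g i
  · simp [hi, abs_of_nonneg]
  · simp [hi, abs_of_neg (not_le.1 hi)]

lemma integral_gauge_ge {n : ℕ} {B : Set (Euc n)} (hB : IsSymmConvexBody B)
    (hU : StdUncond B) {g : Euc n}
    (h : HasGradientAt (gauge B) g (WithLp.toLp 2 fun _ => 1)) :
    (∫ t, |t| ∂gaussianReal 0 1) * gauge B (WithLp.toLp 2 fun _ => 1) ≤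
      ∫ x, gauge B x ∂_root_.stdGaussian n := by
  have hint : Integrable (fun x : Euc n => ∑ i, g i * |x i|) (_root_.stdGaussian n) :=
    integrable_finsetSum _ fun i _ => (integrable_abs_coord i).const_mul _
  have hpt : ∀ x : Euc n, ∑ i, g i * |x i| ≤ gauge B x := by
    intro x
    have h1 := gradient_gauge_apply_le hB h (WithLp.toLp 2 fun i => |x i|)
    have h2 := hU (fun i => x i) (fun i => if 0 ≤ x i then 1 else -1)
      (fun i => by split_ifs <;> simp)
    have h3 : (fun i => (if 0 ≤ x i then (1 : ℝ) else -1) * x i) = fun i => |x i| := by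
      ext i
      by_cases hi : 0 ≤ x i
      · simp [hi, abs_of_nonneg]
      · simp [hi, abs_of_neg (not_le.1 hi)]
    rw [h3] at h2
    exact h1.trans h2.le
  have hgauge : Integrable (gauge B) (_root_.stdGaussian n) := by
    simpa using integrable_gauge_rpow hB zero_le_one
  refine le_trans (le_of_eq ?_) (integral_mono hint hgauge hpt)
  rw [integral_finsetSum _ fun i _ => (integrable_abs_coord i).const_mul _]
  simp_rw [integral_const_mul, integral_abs_coord]
  rw [← gradient_gauge_apply_self h, Finset.mul_sum]
  exact Finset.sum_congr rfl fun i _ => by simp [mul_comm]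

/-- Lyapunov's inequality `E X^(2p-2) (E X)² ≤ E X^(2p)` for a nonnegative random variable. -/
lemma integral_rpow_mul_sq_le {Ω : Type*} [MeasurableSpace Ω] {μ : Measure Ω}
    [IsProbabilityMeasure μ] {X : Ω → ℝ} (hX : ∀ ω, 0 ≤ X ω) (hint : Integrable X μ) {p : ℝ}
    (hp : 1 ≤ p) (h1 : Integrable (fun ω => X ω ^ (2 * p - 2)) μ)
    (h2 : Integrable (fun ω => X ω ^ (2 * p)) μ) :
    (∫ ω, X ω ^ (2 * p - 2) ∂μ) * (∫ ω, X ω ∂μ) ^ 2 ≤ ∫ ω, X ω ^ (2 * p) ∂μ := by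
  have hp0 : 0 < p := by linarith
  have hM : 0 ≤ ∫ ω, X ω ∂μ := integral_nonneg hX
  have hJ : (∫ ω, X ω ∂μ) ^ (2 * p) ≤ ∫ ω, X ω ^ (2 * p) ∂μ :=
    (convexOn_rpow (by linarith : 1 ≤ 2 * p)).map_integral_le
      (Real.continuous_rpow_const (by positivity)).continuousOn isClosed_Ici
      (ae_of_all _ hX) hint h2
  set M := ∫ ω, X ω ∂μ
  have hY : ∀ ω, X ω ^ (2 * p - 2) * M ^ 2 ≤
      (1 - p⁻¹) * X ω ^ (2 * p) + p⁻¹ * M ^ (2 * p) := by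
    intro ω
    have h := Real.geom_mean_le_arith_mean2_weighted (w₁ := 1 - p⁻¹) (w₂ := p⁻¹)
      (p₁ := X ω ^ (2 * p)) (p₂ := M ^ (2 * p))
      (sub_nonneg.2 (inv_le_one_of_one_le₀ hp)) (by positivity)
      (Real.rpow_nonneg (hX ω) _) (Real.rpow_nonneg hM _) (by ring)
    rw [← Real.rpow_mul (hX ω), ← Real.rpow_mul hM] at h
    have e1 : 2 * p * (1 - p⁻¹) = 2 * p - 2 := by field_simp
    have e2 : 2 * p * p⁻¹ = (2 : ℕ) := by
      field_simp
      norm_num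
    rwa [e1, e2, Real.rpow_natCast] at h
  rw [← integral_mul_const]
  calc ∫ ω, X ω ^ (2 * p - 2) * M ^ 2 ∂μ
      ≤ ∫ ω, ((1 - p⁻¹) * X ω ^ (2 * p) + p⁻¹ * M ^ (2 * p)) ∂μ :=
        integral_mono (h1.mul_const _) ((h2.const_mul _).add (integrable_const _)) hY
    _ = (1 - p⁻¹) * ∫ ω, X ω ^ (2 * p) ∂μ + p⁻¹ * M ^ (2 * p) := by
        rw [integral_add (h2.const_mul _) (integrable_const _), integral_const_mul]
        simp
    _ ≤ (1 - p⁻¹) * ∫ ω, X ω ^ (2 * p) ∂μ + p⁻¹ * ∫ ω, X ω ^ (2 * p) ∂μ := by gcongr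
    _ = ∫ ω, X ω ^ (2 * p) ∂μ := by ring

lemma flatPart_sq_le {n : ℕ} (B : Set (Euc n)) (gradB : Euc n → Euc n) (i : Fin n) (x : Euc n) :
    flatPart B gradB i x ^ 2 ≤
      (n : ℝ) ^ (-(1 : ℝ) / 8) * (∫ y, gauge B y ∂_root_.stdGaussian n) * |gradB x i| := by
  unfold flatPart
  split_ifs with h
  · rw [← sq_abs, sq]
    gcongr
  · have : 0 ≤ ∫ y, gauge B y ∂_root_.stdGaussian n := integral_nonneg fun y => gauge_nonneg y
    rw [zero_pow two_ne_zero]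
    positivity

lemma eventually_log_sq_le {m : ℝ} (hm : 0 < m) :
    ∀ᶠ n : ℕ in atTop, Real.log n ^ 2 ≤ m * (n : ℝ) ^ ((1 : ℝ) / 16) := by
  have h := ((isLittleO_log_rpow_rpow_atTop 2 (by norm_num : (0 : ℝ) < 1 / 16)).bound hm)
  filter_upwards [tendsto_natCast_atTop_atTop.eventually h] with n hn
  rw [Real.norm_of_nonneg (Real.rpow_nonneg (Nat.cast_nonneg n) _), Real.rpow_two] at hn
  exact (le_abs_self _).trans hn

/-- **The flat part estimate**: for a smooth origin-symmetric convex body in the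
ℓ-position with `1`-unconditional standard basis, for all `1 ≤ p ≤ c·log n`,
`p²·E(‖G‖_B^{2p−2}·Σᵢ Fᵢ²(B,G)) ≤ n^{−1/16}·E‖G‖_B^{2p}`. -/
theorem flat_part_estimate :
    ∃ (n₀ : ℕ) (c : ℝ), 0 < c ∧ ∀ n : ℕ, n₀ ≤ n →
      ∀ B : Set (Euc n), IsSymmConvexBody B → IsEllPosition B → StdUncond B →
      ∀ gradB : Euc n → Euc n,
        (∀ x : Euc n, x ≠ 0 → HasGradientAt (gauge B) (gradB x) x) →
      ∀ p : ℝ, 1 ≤ p → p ≤ c * Real.log n →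
        p ^ 2 * (∫ x, gauge B x ^ (2 * p - 2) * ∑ i, flatPart B gradB i x ^ 2
            ∂stdGaussian n) ≤
          (n : ℝ) ^ (-(1 : ℝ) / 16) * ∫ x, gauge B x ^ (2 * p) ∂stdGaussian n := by
  have hm := integral_abs_gaussianReal_pos
  set m := ∫ t, |t| ∂gaussianReal 0 1 with hm_def
  obtain ⟨N, hN⟩ := eventually_atTop.1 (eventually_log_sq_le hm)
  refine ⟨max N 1, 1, one_pos, fun n hn B hB _ hU gradB hgrad p hp1 hp2 => ?_⟩
  have hn0 : 0 < n := lt_of_lt_of_le one_pos (le_of_max_le_right hn)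
  have hnR : (0 : ℝ) < n := by exact_mod_cast hn0
  rw [one_mul] at hp2
  have hpsq : p ^ 2 ≤ m * (n : ℝ) ^ ((1 : ℝ) / 16) :=
    (pow_le_pow_left₀ (by linarith) hp2 2).trans (hN n (le_of_max_le_left hn))
  have hone : (WithLp.toLp 2 fun _ => 1 : Euc n) ≠ 0 := fun h => by
    simpa using congrArg (fun x : Euc n => x ⟨0, hn0⟩) h
  have hM := integral_gauge_ge hB hU (hgrad _ hone)
  have hint : Integrable (gauge B) (_root_.stdGaussian n) := by
    simpa using integrable_gauge_rpow hB zero_le_one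
  have hint1 := integrable_gauge_rpow hB (by linarith : 0 ≤ 2 * p - 2)
  have hint2 := integrable_gauge_rpow hB (by linarith : 0 ≤ 2 * p)
  have hLy := integral_rpow_mul_sq_le (fun x => gauge_nonneg x) hint hp1 hint1 hint2
  have hM0 : 0 ≤ ∫ x, gauge B x ∂_root_.stdGaussian n := integral_nonneg fun x => gauge_nonneg x
  rw [← hm_def] at hM
  set M := ∫ x, gauge B x ∂_root_.stdGaussian n with hM_def
  set I := ∫ x, gauge B x ^ (2 * p) ∂_root_.stdGaussian n
  have hI : 0 ≤ I := integral_nonneg fun x => Real.rpow_nonneg (gauge_nonneg x) _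
  have hsum : ∀ x : Euc n, x ≠ 0 →
      ∑ i, flatPart B gradB i x ^ 2 ≤ (n : ℝ) ^ (-(1 : ℝ) / 8) * M * (M / m) := by
    intro x hx
    calc ∑ i, flatPart B gradB i x ^ 2
        ≤ ∑ i, (n : ℝ) ^ (-(1 : ℝ) / 8) * M * |gradB x i| :=
          Finset.sum_le_sum fun i _ => flatPart_sq_le B gradB i x
      _ = (n : ℝ) ^ (-(1 : ℝ) / 8) * M * ∑ i, |gradB x i| := by rw [Finset.mul_sum]
      _ ≤ (n : ℝ) ^ (-(1 : ℝ) / 8) * M * (M / m) := by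
          gcongr
          refine (sum_abs_gradient_le hB hU (hgrad x hx)).trans ?_
          rw [le_div_iff₀ hm, mul_comm]
          exact hM
  have hE : ∫ x, gauge B x ^ (2 * p - 2) * ∑ i, flatPart B gradB i x ^ 2 ∂_root_.stdGaussian n ≤
      (n : ℝ) ^ (-(1 : ℝ) / 8) / m * I := by
    calc ∫ x, gauge B x ^ (2 * p - 2) * ∑ i, flatPart B gradB i x ^ 2 ∂_root_.stdGaussian n
        ≤ ∫ x, gauge B x ^ (2 * p - 2) * ((n : ℝ) ^ (-(1 : ℝ) / 8) * M * (M / m))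
            ∂_root_.stdGaussian n := by
          refine integral_mono_of_nonneg (ae_of_all _ fun x => ?_) (hint1.mul_const _) ?_
          · exact mul_nonneg (Real.rpow_nonneg (gauge_nonneg x) _)
              (Finset.sum_nonneg fun i _ => sq_nonneg _)
          · filter_upwards [ae_ne_zero_stdGaussian hn0] with x hx
            exact mul_le_mul_of_nonneg_left (hsum x hx) (Real.rpow_nonneg (gauge_nonneg x) _)
      _ = (n : ℝ) ^ (-(1 : ℝ) / 8) / m *
            ((∫ x, gauge B x ^ (2 * p - 2) ∂_root_.stdGaussian n) * M ^ 2) := by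
          rw [integral_mul_const]
          ring
      _ ≤ (n : ℝ) ^ (-(1 : ℝ) / 8) / m * I := by gcongr
  calc _ ≤ p ^ 2 * ((n : ℝ) ^ (-(1 : ℝ) / 8) / m * I) := by gcongr
    _ ≤ m * (n : ℝ) ^ ((1 : ℝ) / 16) * ((n : ℝ) ^ (-(1 : ℝ) / 8) / m * I) := by gcongr
    _ = (n : ℝ) ^ ((1 : ℝ) / 16) * (n : ℝ) ^ (-(1 : ℝ) / 8) * I := by field_simp
    _ = (n : ℝ) ^ (-(1 : ℝ) / 16) * I := by
        rw [← Real.rpow_add hnR]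
        norm_num
end
end

section
/- Let 0 < a < 1 < b and let F := B₂² ∩ {(x₁,x₂) ∈ ℝ² : x₁²/a² + x₂²/b² ≤ 1}, where B₂² is the Euclidean unit disk in the plane. Then for every invertible linear map T: ℝ² → ℝ² and every real d ≥ 1 such that T(F) ⊆ B₂² ⊆ d·T(F), one has d ≥ √((2b² − a²b² − 1)/(b² − a²)) = √(1 + (b² − 1)(1 − a²)/(b² − a²)). In particular, the Banach–Mazur distance from F to B₂² is at least √(1 + (b² − 1)(1 − a²)/(b² − a²)). -/
open scoped Pointwise

noncomputable section

/-- If the unit ball is covered by `d` times the image of `F` under a linear equivalence `T`, then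
every vector `x` is a multiple `(d * ‖T x‖) • f` of some `f ∈ F`. -/
theorem exists_eq_smul_of_closedBall_subset_smul_image
    {E G : Type*} [AddCommGroup E] [Module ℝ E] [NormedAddCommGroup G] [NormedSpace ℝ G]
    {F : Set E} {T : E ≃ₗ[ℝ] G} {d : ℝ}
    (h : Metric.closedBall (0 : G) 1 ⊆ d • (⇑T '' F)) (x : E) :
    ∃ f ∈ F, x = (d * ‖T x‖) • f := by
  have hmem : (‖T x‖⁻¹ • T x) ∈ Metric.closedBall (0 : G) 1 := by
    rw [mem_closedBall_zero_iff, norm_smul, norm_inv, norm_norm]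
    exact inv_mul_le_one
  obtain ⟨_, ⟨f, hf, rfl⟩, hfx⟩ := h hmem
  refine ⟨f, hf, T.injective ?_⟩
  rcases eq_or_ne (T x) 0 with hx | hx
  · simp [hx]
  · have hfx' : d • T f = ‖T x‖⁻¹ • T x := hfx
    rw [map_smul, mul_comm, mul_smul, hfx', smul_inv_smul₀ (norm_ne_zero_iff.2 hx)]

/-- **Distance of the disk–ellipse intersection to the disk.** Let `0 < a < 1 < b` and
`F = B₂² ∩ {x : x₁²/a² + x₂²/b² ≤ 1}`. If an invertible linear image of `F` satisfies
`T(F) ⊆ B₂² ⊆ d·T(F)` for some `d ≥ 1`, then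
`d ≥ √((2b² − a²b² − 1)/(b² − a²)) = √(1 + (b² − 1)(1 − a²)/(b² − a²))`;
in particular the Banach–Mazur distance from `F` to `B₂²` is at least this quantity. -/
theorem disk_ellipse_intersection_distance
    (a b : ℝ) (ha : 0 < a) (ha1 : a < 1) (hb : 1 < b)
    (F : Set (EuclideanSpace ℝ (Fin 2)))
    (hF : F = Metric.closedBall (0 : EuclideanSpace ℝ (Fin 2)) 1 ∩
      {x : EuclideanSpace ℝ (Fin 2) | x 0 ^ 2 / a ^ 2 + x 1 ^ 2 / b ^ 2 ≤ 1})
    (T : EuclideanSpace ℝ (Fin 2) ≃ₗ[ℝ] EuclideanSpace ℝ (Fin 2)) (d : ℝ) (hd : 1 ≤ d)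
    (h₁ : ⇑T '' F ⊆ Metric.closedBall (0 : EuclideanSpace ℝ (Fin 2)) 1)
    (h₂ : Metric.closedBall (0 : EuclideanSpace ℝ (Fin 2)) 1 ⊆ d • (⇑T '' F)) :
    Real.sqrt ((2 * b ^ 2 - a ^ 2 * b ^ 2 - 1) / (b ^ 2 - a ^ 2)) ≤ d ∧
    Real.sqrt (1 + (b ^ 2 - 1) * (1 - a ^ 2) / (b ^ 2 - a ^ 2)) ≤ d := by
  have hab : 0 < b ^ 2 - a ^ 2 := by nlinarith
  have hmemF : ∀ x : EuclideanSpace ℝ (Fin 2),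
      x ∈ F ↔ x 0 ^ 2 + x 1 ^ 2 ≤ 1 ∧ x 0 ^ 2 / a ^ 2 + x 1 ^ 2 / b ^ 2 ≤ 1 := by
    intro x
    rw [hF, Set.mem_inter_iff, mem_closedBall_zero_iff, ← sq_le_one_iff₀ (norm_nonneg x),
      EuclideanSpace.real_norm_sq_eq, Fin.sum_univ_two, Set.mem_ofPred_eq]
  set u : EuclideanSpace ℝ (Fin 2) := !₂[1, 0] with hu
  set v : EuclideanSpace ℝ (Fin 2) := !₂[0, 1] with hv
  -- the vertex `(a, 0)` of the ellipse and the vertex `(0, 1)` of the disk lie on the boundary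
  have hTu : 1 / a ^ 2 ≤ d ^ 2 * ‖T u‖ ^ 2 := by
    obtain ⟨f, hf, hfu⟩ := exists_eq_smul_of_closedBall_subset_smul_image h₂ u
    have hf' := ((hmemF f).1 hf).2
    have h0 : 1 = d * ‖T u‖ * f 0 := by simpa [hu] using congrArg (fun x => x 0) hfu
    have hf0 : f 0 ^ 2 / a ^ 2 ≤ 1 :=
      le_trans (le_add_of_nonneg_right (by positivity)) hf'
    calc 1 / a ^ 2 = (d * ‖T u‖ * f 0) ^ 2 / a ^ 2 := by rw [← h0, one_pow]
      _ = d ^ 2 * ‖T u‖ ^ 2 * (f 0 ^ 2 / a ^ 2) := by ring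
      _ ≤ d ^ 2 * ‖T u‖ ^ 2 := mul_le_of_le_one_right (by positivity) hf0
  have hTv : 1 ≤ d ^ 2 * ‖T v‖ ^ 2 := by
    obtain ⟨f, hf, hfv⟩ := exists_eq_smul_of_closedBall_subset_smul_image h₂ v
    have hf' := ((hmemF f).1 hf).1
    have h1 : 1 = d * ‖T v‖ * f 1 := by simpa [hv] using congrArg (fun x => x 1) hfv
    calc 1 = (d * ‖T v‖ * f 1) ^ 2 := by rw [← h1, one_pow]
      _ = d ^ 2 * ‖T v‖ ^ 2 * f 1 ^ 2 := by ring
      _ ≤ d ^ 2 * ‖T v‖ ^ 2 :=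
        mul_le_of_le_one_right (by positivity) (by nlinarith [sq_nonneg (f 0)])
  -- the corners `(±√X, ±√Y)` where the circle meets the ellipse
  set X := a ^ 2 * (b ^ 2 - 1) / (b ^ 2 - a ^ 2) with hX
  set Y := b ^ 2 * (1 - a ^ 2) / (b ^ 2 - a ^ 2) with hY
  have hX0 : 0 ≤ X := div_nonneg (mul_nonneg (sq_nonneg a) (by nlinarith)) hab.le
  have hY0 : 0 ≤ Y := div_nonneg (mul_nonneg (sq_nonneg b) (by nlinarith)) hab.le
  have hcircle : X + Y = 1 := by
    rw [hX, hY]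
    field_simp
    ring
  have hellipse : X / a ^ 2 + Y / b ^ 2 = 1 := by
    rw [hX, hY]
    field_simp
    ring
  have hcorner : ∀ s t : ℝ, s ^ 2 = X → t ^ 2 = Y → ‖s • T u + t • T v‖ ^ 2 ≤ 1 := by
    intro s t hs ht
    have hst : s • u + t • v ∈ F := by
      rw [hmemF]
      simp [hu, hv, hs, ht, hcircle, hellipse]
    have h := mem_closedBall_zero_iff.1 (h₁ ⟨_, hst, rfl⟩)
    rw [map_add, map_smul, map_smul] at h
    exact pow_le_one₀ (norm_nonneg _) h
  have hXY : X * ‖T u‖ ^ 2 + Y * ‖T v‖ ^ 2 ≤ 1 := by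
    have hp := hcorner (√X) (√Y) (Real.sq_sqrt hX0) (Real.sq_sqrt hY0)
    have hm := hcorner (√X) (-√Y) (Real.sq_sqrt hX0) (by rw [neg_sq, Real.sq_sqrt hY0])
    rw [neg_smul, ← sub_eq_add_neg, norm_sub_sq_real] at hm
    rw [norm_add_sq_real] at hp
    simp only [norm_smul, mul_pow, Real.norm_eq_abs, sq_abs, Real.sq_sqrt hX0,
      Real.sq_sqrt hY0] at hp hm
    linarith
  have hkey : X / a ^ 2 + Y ≤ d ^ 2 :=
    calc X / a ^ 2 + Y = X * (1 / a ^ 2) + Y * 1 := by ring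
      _ ≤ X * (d ^ 2 * ‖T u‖ ^ 2) + Y * (d ^ 2 * ‖T v‖ ^ 2) := by gcongr
      _ = d ^ 2 * (X * ‖T u‖ ^ 2 + Y * ‖T v‖ ^ 2) := by ring
      _ ≤ d ^ 2 := mul_le_of_le_one_right (sq_nonneg d) hXY
  have hd0 : 0 ≤ d := zero_le_one.trans hd
  constructor <;> refine Real.sqrt_le_iff.2 ⟨hd0, le_of_eq_of_le ?_ hkey⟩ <;>
  · rw [hX, hY]
    field_simp
    ring
end
end
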